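/- Let H be a finite-dimensional real inner product space, let A, B ⊆ H be nonempty closed convex sets with A ∩ B = ∅, and let λ ∈ (0, 2). Define the Douglas–Rachford operator T = (1 − λ/2) Id + (λ/2) R_B R_A, where R_C = 2 P_C − Id and P_C denotes the metric projection onto a closed convex set C. Then for any x₀ ∈ H, the sequence defined by x_{n+1} = T(x_n) satisfies ‖x_n‖ → +∞. -/

import Mathlib

open Filter

section

variable {H : Type*} [NormedAddCommGroup H] [InnerProductSpace ℝ H]

open scoped RealInnerProductSpace Topology

theorem inner_sub_nearest_le_zero {C : Set H} (hC : Convex ℝ C) {x p : H} (hp : p ∈ C)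
    (hmin : ∀ a ∈ C, ‖p - x‖ ≤ ‖a - x‖) : ∀ a ∈ C, ⟪x - p, a - p⟫ ≤ 0 := by
  rw [← norm_eq_iInf_iff_real_inner_le_zero hC hp]
  have : Nonempty C := ⟨⟨p, hp⟩⟩
  refine le_antisymm (le_ciInf fun a => ?_) (ciInf_le ⟨0, ?_⟩ (⟨p, hp⟩ : C))
  · rw [norm_sub_rev, norm_sub_rev x]
    exact hmin a a.2
  · rintro _ ⟨a, rfl⟩
    exact norm_nonneg _

theorem norm_reflector_sub_le {C : Set H} (hC : Convex ℝ C) {P : H → H}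
    (hP : ∀ x, P x ∈ C ∧ ∀ a ∈ C, ‖P x - x‖ ≤ ‖a - x‖) (x y : H) :
    ‖(2 • P x - x) - (2 • P y - y)‖ ≤ ‖x - y‖ := by
  have h1 := inner_sub_nearest_le_zero hC (hP x).1 (hP x).2 (P y) (hP y).1
  have h2 := inner_sub_nearest_le_zero hC (hP y).1 (hP y).2 (P x) (hP x).1
  have e : (2 • P x - x) - (2 • P y - y) = (2 : ℝ) • (P x - P y) - (x - y) := by module
  have h3 : ⟪P x - P y, P x - P y⟫ ≤ ⟪P x - P y, x - y⟫ := by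
    simp only [inner_sub_left, inner_sub_right] at h1 h2 ⊢
    rw [real_inner_comm (P x) x, real_inner_comm (P y) x, real_inner_comm (P x) y,
      real_inner_comm (P y) y] at *
    linarith [real_inner_comm (P x) (P y)]
  rw [real_inner_self_eq_norm_sq] at h3
  refine le_of_sq_le_sq ?_ (norm_nonneg _)
  rw [e, norm_sub_sq_real, norm_smul, real_inner_smul_left, mul_pow]
  norm_num
  linarith

theorem norm_convex_combination_sq (α : ℝ) (u w : H) :
    ‖(1 - α) • u + α • w‖ ^ 2
      = (1 - α) * ‖u‖ ^ 2 + α * ‖w‖ ^ 2 - α * (1 - α) * ‖u - w‖ ^ 2 := by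
  rw [norm_add_sq_real, norm_sub_sq_real, norm_smul, norm_smul, real_inner_smul_left,
    real_inner_smul_right, mul_pow, mul_pow, Real.norm_eq_abs, Real.norm_eq_abs, sq_abs, sq_abs]
  ring

theorem eq_of_norm_convex_combination_eq {α : ℝ} (h0 : 0 < α) (h1 : α < 1) {u w : H}
    (hw : ‖w‖ ≤ ‖u‖) (h : ‖(1 - α) • u + α • w‖ = ‖u‖) : u = w := by
  have key := norm_convex_combination_sq α u w
  rw [h] at key
  have hsq : ‖w‖ ^ 2 ≤ ‖u‖ ^ 2 := by gcongr
  have hα : 0 < α * (1 - α) := mul_pos h0 (by linarith)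
  have h2 : α * (1 - α) * ‖u - w‖ ^ 2 ≤ 0 := by nlinarith
  have h3 : ‖u - w‖ ^ 2 ≤ 0 := nonpos_of_mul_nonpos_right h2 hα
  exact sub_eq_zero.mp (norm_eq_zero.mp (pow_eq_zero_iff two_ne_zero |>.mp
    (le_antisymm h3 (sq_nonneg _))))

theorem norm_convex_combination_le {α : ℝ} (h0 : 0 ≤ α) (h1 : α ≤ 1) {u w : H}
    (hw : ‖w‖ ≤ ‖u‖) : ‖(1 - α) • u + α • w‖ ≤ ‖u‖ := by
  refine (norm_add_le _ _).trans ?_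
  rw [norm_smul, norm_smul, Real.norm_of_nonneg h0, Real.norm_of_nonneg (sub_nonneg.2 h1)]
  nlinarith

/-- A cluster point of an orbit of an averaged nonexpansive map is a fixed point. -/
theorem isFixedPt_of_tendsto_orbit_subseq {S T : H → H} {α : ℝ} (h0 : 0 < α) (h1 : α < 1)
    (hS : ∀ x y, ‖S x - S y‖ ≤ ‖x - y‖) (hT : ∀ x, T x = (1 - α) • x + α • S x)
    {x : ℕ → H} (hx : ∀ k, x (k + 1) = T (x k)) {φ : ℕ → ℕ} (hφ : StrictMono φ) {y : H}
    (hy : Tendsto (x ∘ φ) atTop (𝓝 y)) : T y = y := by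
  have hsub : ∀ a b, T a - T b = (1 - α) • (a - b) + α • (S a - S b) := fun a b => by
    rw [hT, hT]; module
  have hTle : ∀ a b, ‖T a - T b‖ ≤ ‖a - b‖ := fun a b => by
    rw [hsub]; exact norm_convex_combination_le h0.le h1.le (hS a b)
  have hTc : Continuous T := (LipschitzWith.of_dist_le_mul (K := 1) fun a b => by
    simpa [dist_eq_norm] using hTle a b).continuous
  have hanti : Antitone fun k => ‖x k - T (x k)‖ := antitone_nat_of_succ_le fun k => by
    simp only [hx]; exact hTle _ _
  have hlim : Tendsto (fun k => ‖x k - T (x k)‖) atTop (𝓝 (⨅ k, ‖x k - T (x k)‖)) :=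
    tendsto_atTop_ciInf hanti ⟨0, by rintro _ ⟨a, rfl⟩; exact norm_nonneg _⟩
  have hstep : ∀ z, ‖T z - T (T z)‖ = ‖z - T z‖ → T z - T (T z) = z - T z := fun z hz => by
    rw [hsub] at hz ⊢
    rw [← eq_of_norm_convex_combination_eq h0 h1 (hS z (T z)) hz]
    module
  have hshift : ∀ m : ℕ, Tendsto (fun k => x (φ k + m)) atTop (𝓝 (T^[m] y)) := fun m => by
    induction m with
    | zero => exact hy
    | succ m ih =>
      rw [Function.iterate_succ_apply']
      simp only [← add_assoc, hx]
      exact (hTc.tendsto _).comp ih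
  have hdisp : ∀ m : ℕ, ‖T^[m] y - T (T^[m] y)‖ = ⨅ k, ‖x k - T (x k)‖ := fun m =>
    tendsto_nhds_unique ((hshift m).sub ((hTc.tendsto _).comp (hshift m))).norm
      (hlim.comp ((tendsto_add_atTop_nat m).comp hφ.tendsto_atTop))
  have hconst : ∀ m : ℕ, T^[m] y - T (T^[m] y) = y - T y := fun m => by
    induction m with
    | zero => rfl
    | succ m ih =>
      rw [← ih, Function.iterate_succ_apply']
      refine hstep _ ?_
      rw [hdisp, ← Function.iterate_succ_apply' T, hdisp]
  have hiter : ∀ m : ℕ, T^[m] y = y - (m : ℝ) • (y - T y) := fun m => by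
    induction m with
    | zero => simp
    | succ m ih =>
      have h := hconst m
      rw [Function.iterate_succ_apply', ← sub_sub_cancel (T^[m] y) (T (T^[m] y)), h, ih]
      push_cast
      module
  have hclose : ∀ m n, ‖x (n + m) - T^[m] y‖ ≤ ‖x n - y‖ := fun m n => by
    induction m with
    | zero => exact le_rfl
    | succ m ih =>
      rw [Function.iterate_succ_apply', ← add_assoc, hx]
      exact (hTle _ _).trans ih
  have hbound : ∀ k, ‖y - T y‖ ≤ ‖x (φ (k + 1)) - y‖ + ‖x (φ k) - y‖ := fun k => by
    obtain ⟨m, hm⟩ := Nat.exists_eq_add_of_lt (hφ (Nat.lt_succ_self k))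
    have hc := hclose (m + 1) (φ k)
    have e : ((m + 1 : ℕ) : ℝ) • (y - T y)
        = (x (φ k + (m + 1)) - T^[m + 1] y) - (x (φ k + (m + 1)) - y) := by
      rw [hiter]; module
    have hle : ‖y - T y‖ ≤ ‖((m + 1 : ℕ) : ℝ) • (y - T y)‖ := by
      rw [norm_smul, Real.norm_natCast]
      exact le_mul_of_one_le_left (norm_nonneg _) (by exact_mod_cast Nat.le_add_left 1 m)
    rw [e] at hle
    rw [show φ (k + 1) = φ k + (m + 1) from hm]
    linarith [norm_sub_le (x (φ k + (m + 1)) - T^[m + 1] y) (x (φ k + (m + 1)) - y)]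
  have hz : Tendsto (fun k => ‖x (φ k) - y‖) atTop (𝓝 0) :=
    tendsto_iff_norm_sub_tendsto_zero.mp hy
  have hle := ge_of_tendsto' ((hz.comp (tendsto_add_atTop_nat 1)).add hz) hbound
  rw [add_zero] at hle
  exact (sub_eq_zero.mp (norm_le_zero_iff.mp hle)).symm

end

/-- Divergence of the Douglas–Rachford iteration for two nonempty closed
convex sets `A`, `B` with `A ∩ B = ∅` in a finite-dimensional real inner product space: for
`λ ∈ (0, 2)` and `T = (1 - λ/2) Id + (λ/2) R_B R_A`, every orbit satisfies `‖x_n‖ → +∞`. -/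
theorem stmt14 {H : Type*} [NormedAddCommGroup H] [InnerProductSpace ℝ H]
    [FiniteDimensional ℝ H]
    (A B : Set H) (hAne : A.Nonempty) (hBne : B.Nonempty)
    (hAclosed : IsClosed A) (hBclosed : IsClosed B)
    (hAconv : Convex ℝ A) (hBconv : Convex ℝ B)
    (hAB : A ∩ B = ∅)
    (lam : ℝ) (hlam0 : 0 < lam) (hlam2 : lam < 2)
    (PA PB : H → H)
    (hPA : ∀ x, PA x ∈ A ∧ ∀ a ∈ A, ‖PA x - x‖ ≤ ‖a - x‖)
    (hPB : ∀ x, PB x ∈ B ∧ ∀ b ∈ B, ‖PB x - x‖ ≤ ‖b - x‖)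
    (T : H → H)
    (hT : ∀ x, T x =
      (1 - lam / 2) • x +
        (lam / 2) • (2 • PB (2 • PA x - x) - (2 • PA x - x)))
    (x0 : H) (x : ℕ → H) (hx0 : x 0 = x0) (hx : ∀ k, x (k + 1) = T (x k)) :
    Tendsto (fun k => ‖x k‖) atTop atTop := by
  by_contra hdiv
  obtain ⟨C, hC⟩ : ∃ C : ℝ, ∃ᶠ k in atTop, ‖x k‖ < C := by
    simpa [tendsto_atTop, Filter.Frequently] using hdiv
  obtain ⟨y, -, φ, hφ, hy⟩ := tendsto_subseq_of_frequently_bounded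
    (Metric.isBounded_closedBall (x := (0 : H)) (r := C))
    (hC.mono fun k hk => mem_closedBall_zero_iff.2 hk.le)
  have hfix : T y = y := isFixedPt_of_tendsto_orbit_subseq (by linarith) (by linarith)
    (fun a b => (norm_reflector_sub_le hBconv hPB _ _).trans (norm_reflector_sub_le hAconv hPA a b))
    hT hx hφ hy
  have hzero : lam • (PB (2 • PA y - y) - PA y) = 0 := by
    rw [← sub_eq_zero.mpr hfix, hT]
    module
  have hPAB : PB (2 • PA y - y) = PA y :=
    sub_eq_zero.mp ((smul_eq_zero.mp hzero).resolve_left hlam0.ne')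
  have hmem : PA y ∈ A ∩ B := ⟨(hPA y).1, hPAB ▸ (hPB _).1⟩
  exact Set.notMem_empty _ (hAB ▸ hmem)
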